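/- Let d and n be positive integers, α ∈ (0,1), and θ : Fin d → ℝ with θ q > 0 for all q. Let μ = Measure.pi (fun _ : Fin n => Measure.pi (fun q : Fin d => Unif(−θ q, θ q))) be the law of n i.i.d. d-dimensional samples whose coordinates are independent symmetric uniforms. Define w̄(w)(q) = max_{i ∈ Fin n} |w i q| and the random hyper-rectangle Ŵ(w) = Set.univ.pi (fun q => Set.Icc (−w̄(w)(q)·(α/d)^{−1/n}) (w̄(w)(q)·(α/d)^{−1/n})). Then μ({w | Set.univ.pi (fun q => Set.Icc (−θ q) (θ q)) ⊆ Ŵ(w)}) ≥ 1 − α. -/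

import Mathlib

open MeasureTheory

/-- `unif a b` is the uniform probability measure on the interval `[a, b]`:
`(b - a)⁻¹` times Lebesgue measure restricted to `[a, b]`. -/
noncomputable def unif (a b : ℝ) : Measure ℝ :=
  (ENNReal.ofReal (b - a))⁻¹ • volume.restrict (Set.Icc a b)

lemma isProbabilityMeasure_unif {a b : ℝ} (hab : a < b) : IsProbabilityMeasure (unif a b) := by
  refine ⟨?_⟩
  have h : ENNReal.ofReal (b - a) ≠ 0 := by simpa using hab
  simp [unif, ENNReal.inv_mul_cancel h ENNReal.ofReal_ne_top]

lemma unif_symm_Ioo_le {t : ℝ} (ht : 0 < t) (c : ℝ) :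
    unif (-t) t (Set.Ioo (-(c * t)) (c * t)) ≤ ENNReal.ofReal c := by
  have hpos : 0 < t - -t := by linarith
  calc unif (-t) t (Set.Ioo (-(c * t)) (c * t))
      ≤ (ENNReal.ofReal (t - -t))⁻¹ * volume (Set.Ioo (-(c * t)) (c * t)) := by
        rw [unif, Measure.smul_apply, smul_eq_mul]
        gcongr
        exact Measure.restrict_le_self
    _ = ENNReal.ofReal c := by
        rw [Real.volume_Ioo, show c * t - -(c * t) = (t - -t) * c by ring,
          ENNReal.ofReal_mul hpos.le, ← mul_assoc, ENNReal.inv_mul_cancel (by simpa using hpos)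
            ENNReal.ofReal_ne_top, one_mul]

/-- The probability that all `n` samples have a small `q`-th coordinate. -/
lemma pi_unif_forall_mem_Ioo_le {d : ℕ} (n : ℕ) {θ : Fin d → ℝ} (hθ : ∀ q, 0 < θ q)
    {c : ℝ} (hc : 0 ≤ c) (q : Fin d) :
    (Measure.pi fun _ : Fin n => Measure.pi fun q : Fin d => unif (-θ q) (θ q))
        {w | ∀ i, w i q ∈ Set.Ioo (-(c * θ q)) (c * θ q)} ≤ ENNReal.ofReal (c ^ n) := by
  have hprob (q) : IsProbabilityMeasure (unif (-θ q) (θ q)) :=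
    isProbabilityMeasure_unif (by linarith [hθ q])
  have hset : {w : Fin n → Fin d → ℝ | ∀ i, w i q ∈ Set.Ioo (-(c * θ q)) (c * θ q)} =
      Set.univ.pi fun _ => Function.eval q ⁻¹' Set.Ioo (-(c * θ q)) (c * θ q) := by
    ext w
    simp
  rw [hset, Measure.pi_pi, Finset.prod_const, Finset.card_univ, Fintype.card_fin,
    (measurePreserving_eval (fun q => unif (-θ q) (θ q)) q).measure_preimage
      measurableSet_Ioo.nullMeasurableSet, ENNReal.ofReal_pow hc]
  gcongr
  exact unif_symm_Ioo_le (hθ q) c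

/-- **Equation (17) of the paper.** For `n` i.i.d. `d`-dimensional samples with independent
symmetric-uniform coordinates `Unif(-θ q, θ q)`, the random hyper-rectangle built from the
per-coordinate scaled sample maxima `w̄ q · (α/d)^{-1/n}` contains the true support
`∏ q, [-θ q, θ q]` with probability at least `1 - α`. -/
theorem uniform_product_confidence_support (d n : ℕ) (hd : 0 < d) (hn : 0 < n)
    (α : ℝ) (hα : α ∈ Set.Ioo (0 : ℝ) 1)
    (θ : Fin d → ℝ) (hθ : ∀ q, 0 < θ q) :
    ENNReal.ofReal (1 - α) ≤
      (Measure.pi fun _ : Fin n => Measure.pi fun q : Fin d => unif (-θ q) (θ q))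
        {w : Fin n → Fin d → ℝ |
          Set.univ.pi (fun q => Set.Icc (-θ q) (θ q)) ⊆
            Set.univ.pi (fun q =>
              Set.Icc (-((⨆ i, |w i q|) * (α / d) ^ (-1 / (n : ℝ))))
                ((⨆ i, |w i q|) * (α / d) ^ (-1 / (n : ℝ))))} := by
  have hprob (q) : IsProbabilityMeasure (unif (-θ q) (θ q)) :=
    isProbabilityMeasure_unif (by linarith [hθ q])
  have hd' : (0 : ℝ) < d := by exact_mod_cast hd
  have hαd : 0 < α / d := div_pos hα.1 hd'
  set c : ℝ := (α / d) ^ (1 / (n : ℝ)) with hc_def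
  have hc : 0 < c := Real.rpow_pos_of_pos hαd _
  have hcn : c ^ n = α / d := by
    rw [hc_def, one_div, Real.rpow_inv_natCast_pow hαd.le hn.ne']
  have hcinv : (α / d) ^ (-1 / (n : ℝ)) = c⁻¹ := by
    rw [hc_def, neg_div, Real.rpow_neg hαd.le]
  rw [hcinv]
  set μ := Measure.pi fun _ : Fin n => Measure.pi fun q : Fin d => unif (-θ q) (θ q)
  set G := {w : Fin n → Fin d → ℝ | Set.univ.pi (fun q => Set.Icc (-θ q) (θ q)) ⊆
    Set.univ.pi (fun q => Set.Icc (-((⨆ i, |w i q|) * c⁻¹)) ((⨆ i, |w i q|) * c⁻¹))}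
  let B (q : Fin d) := {w : Fin n → Fin d → ℝ | ∀ i, w i q ∈ Set.Ioo (-(c * θ q)) (c * θ q)}
  have hcover : Set.univ ⊆ G ∪ ⋃ q, B q := by
    intro w _
    by_cases hw : w ∈ ⋃ q, B q
    · exact Or.inr hw
    refine Or.inl (Set.pi_mono fun q _ => ?_)
    have hq : ∃ i, c * θ q ≤ |w i q| := by
      by_contra! h
      exact hw (Set.mem_iUnion.2 ⟨q, fun i => abs_lt.1 (h i)⟩)
    obtain ⟨i, hi⟩ := hq
    have hle : θ q ≤ (⨆ i, |w i q|) * c⁻¹ := by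
      rw [← div_eq_mul_inv, le_div_iff₀' hc]
      exact hi.trans (le_ciSup (f := fun i => |w i q|) (Set.finite_range _).bddAbove i)
    exact Set.Icc_subset_Icc (neg_le_neg hle) hle
  have hB : μ (⋃ q, B q) ≤ ENNReal.ofReal α :=
    calc μ (⋃ q, B q) ≤ ∑ q, μ (B q) := measure_iUnion_fintype_le μ B
      _ ≤ ∑ _q : Fin d, ENNReal.ofReal (c ^ n) :=
        Finset.sum_le_sum fun q _ => pi_unif_forall_mem_Ioo_le n hθ hc.le q
      _ = ENNReal.ofReal α := by
        rw [Finset.sum_const, Finset.card_univ, Fintype.card_fin, ← ENNReal.ofReal_nsmul, hcn,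
          nsmul_eq_mul, mul_div_cancel₀ _ hd'.ne']
  rw [ENNReal.ofReal_sub _ hα.1.le, ENNReal.ofReal_one, tsub_le_iff_right]
  calc (1 : ENNReal) = μ Set.univ := measure_univ.symm
    _ ≤ μ (G ∪ ⋃ q, B q) := measure_mono hcover
    _ ≤ μ G + μ (⋃ q, B q) := measure_union_le _ _
    _ ≤ μ G + ENNReal.ofReal α := by gcongr
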